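/- arXiv:1710.01797 — 3 statements merged into one kernel-verified Lean document; each statement's English description precedes it below -/
import Mathlib

section
/- For every x < 0 and every v > 0, the normalized Black-Scholes call price satisfies the strict bounds 0 < c(x,v) < e^{x/2}. -/
open Real Set Filter

/-- The standard normal cumulative distribution function Φ. -/
noncomputable def stdNormalCDF (y : ℝ) : ℝ :=
  (Real.sqrt (2 * Real.pi))⁻¹ * ∫ t in Set.Iic y, Real.exp (-t ^ 2 / 2)

/-- The normalized Black-Scholes call price
`c(x,v) = e^{x/2} Φ(x/v + v/2) − e^{−x/2} Φ(x/v − v/2)`. -/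
noncomputable def normCall (x v : ℝ) : ℝ :=
  Real.exp (x / 2) * stdNormalCDF (x / v + v / 2) -
    Real.exp (-x / 2) * stdNormalCDF (x / v - v / 2)

open MeasureTheory

lemma integrable_exp_neg_sq_div_two : Integrable fun t : ℝ ↦ exp (-t ^ 2 / 2) := by
  convert integrable_exp_neg_mul_sq (b := 1 / 2) (by norm_num) using 3
  ring

lemma integral_exp_neg_sq_div_two : ∫ t : ℝ, exp (-t ^ 2 / 2) = √(2 * π) := by
  rw [show 2 * π = π / (1 / 2) by ring, ← integral_gaussian]
  congr 1 with t
  ring_nf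

/-- Strict monotonicity of the integral over a left half-line. -/
lemma setIntegral_Iic_lt_of_forall_lt {f g : ℝ → ℝ} (hf : Integrable f) (hg : Integrable g) {a : ℝ}
    (h : ∀ t < a, f t < g t) : ∫ t in Iic a, f t < ∫ t in Iic a, g t := by
  simp only [integral_Iic_eq_integral_Iio]
  rw [← sub_pos, ← integral_sub hg.integrableOn hf.integrableOn,
    setIntegral_pos_iff_support_of_nonneg_ae (f := fun t ↦ g t - f t) _ (hg.sub hf).integrableOn]
  · have hsub : Iio a ⊆ (Function.support fun t ↦ g t - f t) ∩ Iio a :=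
      fun t ht ↦ ⟨(sub_pos.2 (h t ht)).ne', ht⟩
    exact lt_of_lt_of_le (by simp) (measure_mono hsub)
  · filter_upwards [ae_restrict_mem measurableSet_Iio] with t ht
    exact (sub_pos.2 (h t ht)).le

lemma stdNormalCDF_pos (y : ℝ) : 0 < stdNormalCDF y := by
  have h := setIntegral_Iic_lt_of_forall_lt (a := y) (integrable_zero ℝ ℝ _)
    integrable_exp_neg_sq_div_two fun t _ ↦ exp_pos _
  simp only [Pi.zero_apply, integral_zero] at h
  exact mul_pos (by positivity) h

lemma stdNormalCDF_le_one (y : ℝ) : stdNormalCDF y ≤ 1 := by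
  rw [stdNormalCDF, inv_mul_le_one₀ (by positivity), ← integral_exp_neg_sq_div_two]
  exact setIntegral_le_integral integrable_exp_neg_sq_div_two
    (Eventually.of_forall fun t ↦ (exp_pos _).le)

lemma stdNormalCDF_sub (y v : ℝ) :
    stdNormalCDF (y - v) = (√(2 * π))⁻¹ * ∫ t in Iic y, exp (-(t - v) ^ 2 / 2) := by
  have h := (measurePreserving_sub_right (volume : Measure ℝ) v).setIntegral_preimage_emb
    (measurableEmbedding_subRight v) (fun t ↦ exp (-t ^ 2 / 2)) (Iic (y - v))
  rw [stdNormalCDF, ← h]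
  simp

lemma normCall_pos (x v : ℝ) (hv : 0 < v) : 0 < normCall x v := by
  rw [normCall, show x / v - v / 2 = x / v + v / 2 - v by ring, stdNormalCDF_sub, stdNormalCDF,
    mul_left_comm, mul_left_comm (exp (-x / 2)), ← mul_sub]
  refine mul_pos (by positivity) (sub_pos.2 ?_)
  rw [← integral_const_mul, ← integral_const_mul]
  refine setIntegral_Iic_lt_of_forall_lt
    ((integrable_exp_neg_sq_div_two.comp_sub_right v).const_mul _)
    (integrable_exp_neg_sq_div_two.const_mul _) fun t ht ↦ ?_
  rw [← exp_add, ← exp_add, exp_lt_exp]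
  have hvt : t * v < x + v ^ 2 / 2 := by
    calc t * v < (x / v + v / 2) * v := by gcongr
      _ = x + v ^ 2 / 2 := by field_simp
  linarith

/-- For every `x < 0` and `v > 0`, the normalized Black-Scholes call price satisfies
the strict bounds `0 < c(x,v) < e^{x/2}`. -/
theorem normCall_bounds (x v : ℝ) (hx : x < 0) (hv : 0 < v) :
    0 < normCall x v ∧ normCall x v < Real.exp (x / 2) := by
  refine ⟨normCall_pos x v hv, ?_⟩
  have hle : exp (x / 2) * stdNormalCDF (x / v + v / 2) ≤ exp (x / 2) :=
    mul_le_of_le_one_right (exp_pos _).le (stdNormalCDF_le_one _)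
  have hpos : 0 < exp (-x / 2) * stdNormalCDF (x / v - v / 2) :=
    mul_pos (exp_pos _) (stdNormalCDF_pos _)
  rw [normCall]
  linarith
end

section
/- For every x < 0 and every price p with 0 < p < e^{x/2}, there exists a unique v > 0 such that c(x,v) = p; that is, the implied (time-scaled) volatility exists and is unique. -/
open Real Set Filter

/-- The standard normal density, the derivative of `stdNormalCDF`. -/
noncomputable def stdNormalPDF (y : ℝ) : ℝ :=
  (Real.sqrt (2 * Real.pi))⁻¹ * Real.exp (-y ^ 2 / 2)

lemma stdNormalPDF_pos (y : ℝ) : 0 < stdNormalPDF y := by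
  unfold stdNormalPDF
  positivity

lemma gaussianPDFReal_zero_one : ProbabilityTheory.gaussianPDFReal 0 1 = stdNormalPDF := by
  ext y
  simp [ProbabilityTheory.gaussianPDFReal, stdNormalPDF]

lemma stdNormalCDF_eq_integral (y : ℝ) :
    stdNormalCDF y = ∫ t in Set.Iic y, stdNormalPDF t := by
  simp only [stdNormalCDF, stdNormalPDF, MeasureTheory.integral_const_mul]

lemma integrable_stdNormalPDF : MeasureTheory.Integrable stdNormalPDF := by
  simpa only [gaussianPDFReal_zero_one] using ProbabilityTheory.integrable_gaussianPDFReal 0 1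

lemma continuous_stdNormalPDF : Continuous stdNormalPDF := by
  unfold stdNormalPDF
  fun_prop

lemma stdNormalCDF_eq_cdf :
    stdNormalCDF = ProbabilityTheory.cdf (ProbabilityTheory.gaussianReal 0 1) := by
  ext y
  rw [ProbabilityTheory.cdf_eq_real, MeasureTheory.measureReal_def,
    ProbabilityTheory.gaussianReal_apply_eq_integral 0 one_ne_zero,
    ENNReal.toReal_ofReal
      (MeasureTheory.integral_nonneg fun t ↦ ProbabilityTheory.gaussianPDFReal_nonneg 0 1 t),
    stdNormalCDF_eq_integral]
  simp only [gaussianPDFReal_zero_one]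

lemma tendsto_stdNormalCDF_atBot : Tendsto stdNormalCDF atBot (nhds 0) := by
  rw [stdNormalCDF_eq_cdf]
  exact ProbabilityTheory.tendsto_cdf_atBot _

lemma tendsto_stdNormalCDF_atTop : Tendsto stdNormalCDF atTop (nhds 1) := by
  rw [stdNormalCDF_eq_cdf]
  exact ProbabilityTheory.tendsto_cdf_atTop _

lemma hasDerivAt_stdNormalCDF (y : ℝ) : HasDerivAt stdNormalCDF (stdNormalPDF y) y := by
  have h : stdNormalCDF = fun z ↦ stdNormalCDF 0 + ∫ t in (0 : ℝ)..z, stdNormalPDF t := by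
    ext z
    rw [stdNormalCDF_eq_integral, stdNormalCDF_eq_integral,
      ← intervalIntegral.integral_Iic_sub_Iic integrable_stdNormalPDF.integrableOn
        integrable_stdNormalPDF.integrableOn]
    ring
  rw [h]
  exact (continuous_stdNormalPDF.integral_hasStrictDerivAt 0 y).hasDerivAt.const_add _

lemma exp_mul_stdNormalPDF_add {x v : ℝ} (hv : v ≠ 0) :
    Real.exp (x / 2) * stdNormalPDF (x / v + v / 2) =
      Real.exp (-x / 2) * stdNormalPDF (x / v - v / 2) := by
  simp only [stdNormalPDF]
  rw [mul_left_comm, mul_left_comm (Real.exp (-x / 2)), ← Real.exp_add, ← Real.exp_add]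
  congr 2
  field_simp
  ring

/-- The vega of the normalized call price. -/
lemma hasDerivAt_normCall {x v : ℝ} (hv : v ≠ 0) :
    HasDerivAt (normCall x) (Real.exp (x / 2) * stdNormalPDF (x / v + v / 2)) v := by
  have h1 : HasDerivAt (fun w : ℝ ↦ x / w) (-x / v ^ 2) v := by
    simpa [div_eq_mul_inv] using (hasDerivAt_inv hv).const_mul x
  have h2 : HasDerivAt (fun w : ℝ ↦ w / 2) (1 / 2) v := (hasDerivAt_id v).div_const 2
  have h3 := ((hasDerivAt_stdNormalCDF _).comp v (h1.add h2)).const_mul (Real.exp (x / 2))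
  have h4 := ((hasDerivAt_stdNormalCDF _).comp v (h1.sub h2)).const_mul (Real.exp (-x / 2))
  refine (h3.sub h4).congr_deriv ?_
  simp only [Pi.add_apply, Pi.sub_apply]
  linear_combination (-x / v ^ 2 - 1 / 2) * exp_mul_stdNormalPDF_add (x := x) hv

lemma strictMonoOn_normCall (x : ℝ) : StrictMonoOn (normCall x) (Ioi 0) := by
  refine strictMonoOn_of_deriv_pos (convex_Ioi 0)
    (fun v hv ↦ (hasDerivAt_normCall (ne_of_gt hv)).continuousAt.continuousWithinAt) fun v hv ↦ ?_
  rw [interior_Ioi] at hv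
  rw [(hasDerivAt_normCall (ne_of_gt hv)).deriv]
  exact mul_pos (Real.exp_pos _) (stdNormalPDF_pos _)

lemma tendsto_normCall_nhdsGT_zero {x : ℝ} (hx : x < 0) :
    Tendsto (normCall x) (nhdsWithin 0 (Ioi 0)) (nhds 0) := by
  have h1 : Tendsto (fun v : ℝ ↦ x / v) (nhdsWithin 0 (Ioi 0)) atBot := by
    simpa only [div_eq_mul_inv] using tendsto_inv_nhdsGT_zero.const_mul_atTop_of_neg hx
  have h2 : Tendsto (fun v : ℝ ↦ v / 2) (nhdsWithin 0 (Ioi 0)) (nhds 0) := by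
    simpa using ((continuous_id.div_const (2 : ℝ)).tendsto 0).mono_left nhdsWithin_le_nhds
  have h3 := (tendsto_stdNormalCDF_atBot.comp (h1.atBot_add h2)).const_mul (Real.exp (x / 2))
  have h4 := (tendsto_stdNormalCDF_atBot.comp (h1.atBot_add h2.neg)).const_mul (Real.exp (-x / 2))
  unfold normCall
  simpa [Function.comp_def, sub_eq_add_neg] using h3.sub h4

lemma tendsto_normCall_atTop (x : ℝ) :
    Tendsto (normCall x) atTop (nhds (Real.exp (x / 2))) := by
  have h1 : Tendsto (fun v : ℝ ↦ x / v) atTop (nhds 0) := tendsto_id.const_div_atTop x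
  have h2 : Tendsto (fun v : ℝ ↦ v / 2) atTop atTop := tendsto_id.atTop_div_const two_pos
  have h3 := (tendsto_stdNormalCDF_atTop.comp (h1.add_atTop h2)).const_mul (Real.exp (x / 2))
  have h4 := (tendsto_stdNormalCDF_atBot.comp
    (h1.add_atBot (tendsto_neg_atTop_atBot.comp h2))).const_mul (Real.exp (-x / 2))
  unfold normCall
  simpa [Function.comp_def, sub_eq_add_neg] using h3.sub h4

/-- Existence and uniqueness of the implied (time-scaled) volatility: for every `x < 0`
and every price `0 < p < e^{x/2}` there is a unique `v > 0` with `c(x,v) = p`. -/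
theorem impliedVol_existsUnique (x p : ℝ) (hx : x < 0) (hp0 : 0 < p)
    (hp1 : p < Real.exp (x / 2)) :
    ∃! v : ℝ, 0 < v ∧ normCall x v = p := by
  obtain ⟨a, hap, ha⟩ := (((tendsto_normCall_nhdsGT_zero hx).eventually_lt_const hp0).and
    self_mem_nhdsWithin).exists
  obtain ⟨b, hpb, hab⟩ := (((tendsto_normCall_atTop x).eventually_const_lt hp1).and
    (eventually_ge_atTop a)).exists
  have hcont : ContinuousOn (normCall x) (Icc a b) := fun v hv ↦
    (hasDerivAt_normCall (lt_of_lt_of_le ha hv.1).ne').continuousAt.continuousWithinAt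
  obtain ⟨v, hv, hvp⟩ := intermediate_value_Icc hab hcont ⟨hap.le, hpb.le⟩
  have hv0 : 0 < v := lt_of_lt_of_le ha hv.1
  exact ⟨v, ⟨hv0, hvp⟩, fun w ⟨hw0, hwp⟩ ↦
    (strictMonoOn_normCall x).injOn hw0 hv0 (hwp.trans hvp.symm)⟩
end

section
/- For every fixed x ≠ 0, the function v ↦ c(x,v) on (0,∞) has a unique inflection point at v_c = √(2|x|): its second partial derivative in v equals ∂²c/∂v²(x,v) = (1/√(2π))·e^{−x²/(2v²) − v²/8}·(x²/v³ − v/4), which is strictly positive for 0 < v < √(2|x|), zero at v = √(2|x|), and strictly negative for v > √(2|x|). -/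
open Real Set Filter

/-- The standard normal distribution function is an antiderivative of the Gaussian density. -/
lemma hasDerivAt_stdNormalCDF_s8 (y : ℝ) :
    HasDerivAt stdNormalCDF ((Real.sqrt (2 * Real.pi))⁻¹ * Real.exp (-y ^ 2 / 2)) y := by
  have hcont : Continuous fun t : ℝ => Real.exp (-t ^ 2 / 2) := by fun_prop
  have hint : MeasureTheory.Integrable fun t : ℝ => Real.exp (-t ^ 2 / 2) := by
    convert integrable_exp_neg_mul_sq (b := 1 / 2) (by norm_num) using 3
    ring
  have heq : stdNormalCDF = fun z => (Real.sqrt (2 * Real.pi))⁻¹ *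
      ((∫ t in Set.Iic (0 : ℝ), Real.exp (-t ^ 2 / 2)) + ∫ t in (0 : ℝ)..z,
        Real.exp (-t ^ 2 / 2)) := by
    funext z
    rw [← intervalIntegral.integral_Iic_sub_Iic hint.integrableOn hint.integrableOn,
      add_sub_cancel, stdNormalCDF]
  rw [heq]
  exact ((intervalIntegral.integral_hasDerivAt_right (hcont.intervalIntegrable _ _)
    (hcont.stronglyMeasurableAtFilter _ _) hcont.continuousAt).const_add _).const_mul _

lemma hasDerivAt_normCall_s8 (x : ℝ) {v : ℝ} (hv : v ≠ 0) :
    HasDerivAt (fun v => normCall x v)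
      ((Real.sqrt (2 * Real.pi))⁻¹ * Real.exp (-x ^ 2 / (2 * v ^ 2) - v ^ 2 / 8)) v := by
  have hquot : HasDerivAt (fun v : ℝ => x / v) (-x / v ^ 2) v := by
    refine ((hasDerivAt_const v x).div (hasDerivAt_id v) hv).congr_deriv ?_
    simp
  have hhalf : HasDerivAt (fun v : ℝ => v / 2) (1 / 2) v := (hasDerivAt_id v).div_const 2
  have hplus := ((hasDerivAt_stdNormalCDF_s8 (x / v + v / 2)).comp v
    (hquot.add hhalf)).const_mul (Real.exp (x / 2))
  have hminus := ((hasDerivAt_stdNormalCDF_s8 (x / v - v / 2)).comp v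
    (hquot.sub hhalf)).const_mul (Real.exp (-x / 2))
  have hexp_plus : Real.exp (-x ^ 2 / (2 * v ^ 2) - v ^ 2 / 8) =
      Real.exp (x / 2) * Real.exp (-(x / v + v / 2) ^ 2 / 2) := by
    rw [← Real.exp_add]
    congr 1
    field_simp
    ring
  have hexp_minus : Real.exp (-x ^ 2 / (2 * v ^ 2) - v ^ 2 / 8) =
      Real.exp (-x / 2) * Real.exp (-(x / v - v / 2) ^ 2 / 2) := by
    rw [← Real.exp_add]
    congr 1
    field_simp
    ring
  refine (hplus.sub hminus).congr_deriv ?_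
  linear_combination (-(Real.sqrt (2 * Real.pi))⁻¹ * (-x / v ^ 2 + 1 / 2)) * hexp_plus +
    ((Real.sqrt (2 * Real.pi))⁻¹ * (-x / v ^ 2 - 1 / 2)) * hexp_minus

lemma deriv_deriv_normCall (x : ℝ) {v : ℝ} (hv : v ≠ 0) :
    deriv (deriv (fun v => normCall x v)) v =
      (Real.sqrt (2 * Real.pi))⁻¹ * Real.exp (-x ^ 2 / (2 * v ^ 2) - v ^ 2 / 8) *
        (x ^ 2 / v ^ 3 - v / 4) := by
  have hev : deriv (fun v => normCall x v) =ᶠ[nhds v] fun v =>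
      (Real.sqrt (2 * Real.pi))⁻¹ * Real.exp (-x ^ 2 / (2 * v ^ 2) - v ^ 2 / 8) := by
    filter_upwards [isOpen_ne.mem_nhds hv] with w hw
    exact (hasDerivAt_normCall_s8 x hw).deriv
  have hexponent : HasDerivAt (fun v : ℝ => -x ^ 2 / (2 * v ^ 2) - v ^ 2 / 8)
      (x ^ 2 / v ^ 3 - v / 4) v := by
    refine (((hasDerivAt_const v (-x ^ 2)).div ((hasDerivAt_pow 2 v).const_mul 2)
      (by positivity)).sub ((hasDerivAt_pow 2 v).div_const 8)).congr_deriv ?_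
    field_simp
    ring
  rw [hev.deriv_eq, (hexponent.exp.const_mul _).deriv, mul_assoc]

/-- For fixed `x ≠ 0`, the second derivative in `v` of the normalized Black-Scholes call
price equals `(1/√(2π)) e^{−x²/(2v²) − v²/8} (x²/v³ − v/4)`; it is strictly positive for
`0 < v < √(2|x|)`, zero at `v = √(2|x|)` and strictly negative for `v > √(2|x|)`, so
`v_c = √(2|x|)` is the unique inflection point. -/
theorem normCall_second_derivative (x : ℝ) (hx : x ≠ 0) :
    (∀ v : ℝ, 0 < v →
      deriv (deriv (fun v => normCall x v)) v =
        (Real.sqrt (2 * Real.pi))⁻¹ * Real.exp (-x ^ 2 / (2 * v ^ 2) - v ^ 2 / 8) *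
          (x ^ 2 / v ^ 3 - v / 4)) ∧
    (∀ v : ℝ, 0 < v → v < Real.sqrt (2 * |x|) →
      0 < deriv (deriv (fun v => normCall x v)) v) ∧
    deriv (deriv (fun v => normCall x v)) (Real.sqrt (2 * |x|)) = 0 ∧
    (∀ v : ℝ, Real.sqrt (2 * |x|) < v →
      deriv (deriv (fun v => normCall x v)) v < 0) := by
  have hpos : 0 < Real.sqrt (2 * |x|) := Real.sqrt_pos.mpr (by positivity)
  have hfour : Real.sqrt (2 * |x|) ^ 4 = 4 * x ^ 2 := by
    rw [show Real.sqrt (2 * |x|) ^ 4 = (Real.sqrt (2 * |x|) ^ 2) ^ 2 by ring,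
      Real.sq_sqrt (by positivity), mul_pow, sq_abs]
    norm_num
  have hfactor : ∀ v : ℝ, 0 < v →
      x ^ 2 / v ^ 3 - v / 4 = (Real.sqrt (2 * |x|) ^ 4 - v ^ 4) / (4 * v ^ 3) := by
    intro v hv
    rw [hfour]
    field_simp
  refine ⟨fun v hv => deriv_deriv_normCall x hv.ne', fun v hv hlt => ?_, ?_, fun v hlt => ?_⟩
  · rw [deriv_deriv_normCall x hv.ne', hfactor v hv]
    have := sub_pos.mpr (pow_lt_pow_left₀ hlt hv.le four_ne_zero)
    positivity
  · rw [deriv_deriv_normCall x hpos.ne', hfactor _ hpos, sub_self, zero_div, mul_zero]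
  · have hv := hpos.trans hlt
    rw [deriv_deriv_normCall x hv.ne', hfactor v hv]
    exact mul_neg_of_pos_of_neg (by positivity) (div_neg_of_neg_of_pos
      (sub_neg.mpr (pow_lt_pow_left₀ hlt hpos.le four_ne_zero)) (by positivity))
end
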